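/- Let ξ be an ordering of the Pascal graph and let γ ≠ γ' be paths in X ∖ X'_ξ such that, for some n ≥ 1, γ follows only ξ-minimal edges from the root to a vertex (x,y) and γ' follows only ξ-minimal edges from the root to a vertex (x',y'), where x+y = x'+y' = n and (x,y) ≠ (x',y'). Then the 3-codings of γ and γ' differ: ω_3(γ) ≠ ω_3(γ'). -/

import Mathlib

/-- Vertex reached after `n` moves: (number of `false` moves, number of `true` moves). -/
def vertexAt (γ : ℕ → Bool) (n : ℕ) : ℕ × ℕ :=
  (((Finset.range n).filter fun i => γ i = false).card,
   ((Finset.range n).filter fun i => γ i = true).card)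

def childOf (v : ℕ × ℕ) (m : Bool) : ℕ × ℕ :=
  if m then (v.1, v.2 + 1) else (v.1 + 1, v.2)

def MoveMin (ξ : ℕ × ℕ → Bool) (v : ℕ × ℕ) (m : Bool) : Prop :=
  (childOf v m).1 = 0 ∨ (childOf v m).2 = 0 ∨ m = !ξ (childOf v m)

def MoveMax (ξ : ℕ × ℕ → Bool) (v : ℕ × ℕ) (m : Bool) : Prop :=
  (childOf v m).1 = 0 ∨ (childOf v m).2 = 0 ∨ m = ξ (childOf v m)

def IsMinEdge (ξ : ℕ × ℕ → Bool) (γ : ℕ → Bool) (i : ℕ) : Prop :=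
  MoveMin ξ (vertexAt γ i) (γ i)

def IsMaxEdge (ξ : ℕ × ℕ → Bool) (γ : ℕ → Bool) (i : ℕ) : Prop :=
  MoveMax ξ (vertexAt γ i) (γ i)

def XMin (ξ : ℕ × ℕ → Bool) : Set (ℕ → Bool) := {γ | ∀ i, IsMinEdge ξ γ i}

def XMax (ξ : ℕ × ℕ → Bool) : Set (ℕ → Bool) := {γ | ∀ i, IsMaxEdge ξ γ i}

def XPrime (ξ : ℕ × ℕ → Bool) : Set (ℕ → Bool) :=
  {γ | ∃ δ ∈ XMin ξ ∪ XMax ξ, ∃ N : ℕ, ∀ n, N ≤ n → γ n = δ n}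

/-- The all-ξ-minimal finite path (list of moves) from the root to a vertex. -/
def minPath (ξ : ℕ × ℕ → Bool) : ℕ × ℕ → List Bool
  | (0, 0) => []
  | (x + 1, 0) => minPath ξ (x, 0) ++ [false]
  | (0, y + 1) => minPath ξ (0, y) ++ [true]
  | (x + 1, y + 1) =>
      if ξ (x + 1, y + 1) then minPath ξ (x, y + 1) ++ [false]
      else minPath ξ (x + 1, y) ++ [true]
  termination_by p => p.1 + p.2

/-- The all-ξ-maximal finite path (list of moves) from the root to a vertex. -/
def maxPath (ξ : ℕ × ℕ → Bool) : ℕ × ℕ → List Bool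
  | (0, 0) => []
  | (x + 1, 0) => maxPath ξ (x, 0) ++ [false]
  | (0, y + 1) => maxPath ξ (0, y) ++ [true]
  | (x + 1, y + 1) =>
      if ξ (x + 1, y + 1) then maxPath ξ (x + 1, y) ++ [true]
      else maxPath ξ (x, y + 1) ++ [false]
  termination_by p => p.1 + p.2

open Classical in
/-- The adic (Vershik) transformation determined by ξ (identity where undefined). -/
noncomputable def adicT (ξ : ℕ × ℕ → Bool) (γ : ℕ → Bool) : ℕ → Bool :=
  if h : ∃ i, ¬ IsMaxEdge ξ γ i then
    let i0 := Nat.find h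
    let v := vertexAt γ (i0 + 1)
    let src : ℕ × ℕ := if ξ v then (v.1, v.2 - 1) else (v.1 - 1, v.2)
    fun n =>
      if n < i0 then (minPath ξ src).getD n false
      else if n = i0 then ξ v
      else γ n
  else γ

open Classical in
/-- The inverse adic transformation determined by ξ (identity where undefined). -/
noncomputable def adicTInv (ξ : ℕ × ℕ → Bool) (γ : ℕ → Bool) : ℕ → Bool :=
  if h : ∃ i, ¬ IsMinEdge ξ γ i then
    let i0 := Nat.find h
    let v := vertexAt γ (i0 + 1)
    let src : ℕ × ℕ := if ξ v then (v.1 - 1, v.2) else (v.1, v.2 - 1)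
    fun n =>
      if n < i0 then (maxPath ξ src).getD n false
      else if n = i0 then !ξ v
      else γ n
  else γ

/-- ℤ-iterates of the adic transformation. -/
noncomputable def adicIter (ξ : ℕ × ℕ → Bool) : ℤ → (ℕ → Bool) → (ℕ → Bool)
  | Int.ofNat n, γ => (adicT ξ)^[n] γ
  | Int.negSucc n, γ => (adicTInv ξ)^[n + 1] γ

/-- The k-coding of the orbit of γ: symbols are the initial segments of length k. -/
noncomputable def omegaCode (ξ : ℕ × ℕ → Bool) (k : ℕ) (γ : ℕ → Bool) : ℤ → List Bool :=
  fun t => (List.range k).map (adicIter ξ t γ)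

/-- Ordered list of all initial segments from the root to (x,y), in increasing ξ-order. -/
def segList (ξ : ℕ × ℕ → Bool) : ℕ × ℕ → List (List Bool)
  | (0, 0) => [[]]
  | (x + 1, 0) => (segList ξ (x, 0)).map (· ++ [false])
  | (0, y + 1) => (segList ξ (0, y)).map (· ++ [true])
  | (x + 1, y + 1) =>
      if ξ (x + 1, y + 1) then
        (segList ξ (x, y + 1)).map (· ++ [false]) ++ (segList ξ (x + 1, y)).map (· ++ [true])
      else
        (segList ξ (x + 1, y)).map (· ++ [true]) ++ (segList ξ (x, y + 1)).map (· ++ [false])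
  termination_by p => p.1 + p.2

/-- Level-k coded basic block at a vertex (x,y) with x+y ≥ k, a word over the
alphabet of initial segments of length k. -/
def codedBlock (ξ : ℕ × ℕ → Bool) (k : ℕ) : ℕ × ℕ → List (List Bool)
  | (0, 0) => segList ξ (0, 0)
  | (x + 1, 0) => if x + 1 ≤ k then segList ξ (x + 1, 0) else [List.replicate k false]
  | (0, y + 1) => if y + 1 ≤ k then segList ξ (0, y + 1) else [List.replicate k true]
  | (x + 1, y + 1) =>
      if x + 1 + (y + 1) ≤ k then segList ξ (x + 1, y + 1)
      else if ξ (x + 1, y + 1) then codedBlock ξ k (x, y + 1) ++ codedBlock ξ k (x + 1, y)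
      else codedBlock ξ k (x + 1, y) ++ codedBlock ξ k (x, y + 1)
  termination_by p => p.1 + p.2

/-- Basic block over the alphabet {a,b}, with a = `false` and b = `true`. -/
def basicBlock (ξ : ℕ × ℕ → Bool) : ℕ × ℕ → List Bool
  | (0, 0) => []
  | (_ + 1, 0) => [false]
  | (0, _ + 1) => [true]
  | (x + 1, y + 1) =>
      if ξ (x + 1, y + 1) then basicBlock ξ (x, y + 1) ++ basicBlock ξ (x + 1, y)
      else basicBlock ξ (x + 1, y) ++ basicBlock ξ (x, y + 1)
  termination_by p => p.1 + p.2

/-- The finite word ω_s ω_{s+1} ... ω_{t-1}. -/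
def wordAt (ω : ℤ → List Bool) (s t : ℤ) : List (List Bool) :=
  (List.range (t - s).toNat).map fun u => ω (s + u)

/-- A ξ-consistent factoring scheme for ω ∈ 𝒫_k^ℤ: `cuts j` is the set of starting
positions of the blocks of the level-(k+j) factorization, and `vert j s` is the
vertex whose coded basic block is the block starting at the cut `s`. -/
def IsConsistentScheme (ξ : ℕ × ℕ → Bool) (k : ℕ) (ω : ℤ → List Bool)
    (cuts : ℕ → Set ℤ) (vert : ℕ → ℤ → ℕ × ℕ) : Prop :=
  (∀ j : ℕ, ∀ M : ℤ, ∃ s ∈ cuts j, s < M) ∧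
  (∀ j : ℕ, ∀ M : ℤ, ∃ t ∈ cuts j, M < t) ∧
  (∀ j : ℕ, ∀ s ∈ cuts j, ∀ t ∈ cuts j, s < t → (∀ u ∈ cuts j, ¬(s < u ∧ u < t)) →
      (vert j s).1 + (vert j s).2 = k + j ∧
      wordAt ω s t = codedBlock ξ k (vert j s)) ∧
  (∀ j : ℕ, cuts (j + 1) ⊆ cuts j) ∧
  (∀ j : ℕ, ∀ s ∈ cuts (j + 1), ∀ t ∈ cuts (j + 1), s < t →
      (∀ u ∈ cuts (j + 1), ¬(s < u ∧ u < t)) →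
      ∀ x y : ℕ, vert (j + 1) s = (x + 1, y + 1) →
        ∃ m ∈ cuts j, s < m ∧ m < t ∧ (∀ u ∈ cuts j, s < u → u < t → u = m) ∧
          (if ξ (x + 1, y + 1)
            then vert j s = (x, y + 1) ∧ vert j m = (x + 1, y)
            else vert j s = (x + 1, y) ∧ vert j m = (x, y + 1)))

/-- The natural factoring scheme of the k-coding of γ: a level-(k+j) block begins at
coordinate t exactly when T^t γ begins with an all-ξ-minimal path to its level-(k+j) vertex. -/
noncomputable def natCuts (ξ : ℕ × ℕ → Bool) (k : ℕ) (γ : ℕ → Bool) : ℕ → Set ℤ :=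
  fun j => {t | ∀ i < k + j, IsMinEdge ξ (adicIter ξ t γ) i}

noncomputable def natVert (ξ : ℕ × ℕ → Bool) (k : ℕ) (γ : ℕ → Bool) : ℕ → ℤ → ℕ × ℕ :=
  fun j t => vertexAt (adicIter ξ t γ) (k + j)

open Classical in
/-- The return time r_n of the Kink Lemma, where `g` is the move of γ leaving (i,j). -/
noncomputable def kinkReturn (ξ : ℕ × ℕ → Bool) (i j : ℕ) (g : Bool) : ℕ :=
  let n := i + j
  if MoveMax ξ (i, j) g ∧ MoveMin ξ (i, j) (!g) then n.choose j
  else if (MoveMin ξ (i, j) g ∧ MoveMin ξ (i, j) (!g) ∧ g = true) ∨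
          (MoveMax ξ (i, j) g ∧ MoveMax ξ (i, j) (!g) ∧ g = false) then (n + 1).choose (j + 1)
  else if (MoveMin ξ (i, j) g ∧ MoveMin ξ (i, j) (!g) ∧ g = false) ∨
          (MoveMax ξ (i, j) g ∧ MoveMax ξ (i, j) (!g) ∧ g = true) then (n + 1).choose j
  else (n + 1).choose j + n.choose (j + 1)

/-- Convert a length-k list of moves to a function `Fin k → Bool`. -/
def segFn (k : ℕ) (w : List Bool) : Fin k → Bool := fun idx => w.getD idx false

/-- The subshift Σ_k of the k-codings: sequences all of whose finite subblocks occur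
in some level-k coded basic block. -/
def SigmaK (ξ : ℕ × ℕ → Bool) (k : ℕ) : Set (ℤ → (Fin k → Bool)) :=
  {ω | ∀ (s : ℤ) (l : ℕ), ∃ p : ℕ × ℕ,
    ((List.range l).map fun u => ω (s + u)) <:+: (codedBlock ξ k p).map (segFn k)}

/-- The subshift Σ_ξ ⊆ {a,b}^ℤ of sequences all of whose finite subblocks occur in
some basic block B_ξ(x,y). -/
def SigmaXi (ξ : ℕ × ℕ → Bool) : Set (ℤ → Bool) :=
  {ω | ∀ (s : ℤ) (l : ℕ), ∃ p : ℕ × ℕ,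
    ((List.range l).map fun u => ω (s + u)) <:+: basicBlock ξ p}

/-- The big subshift Σ: sequences all of whose finite subblocks occur in some basic
block B_ξ(x,y) for some ordering ξ. -/
def BigShift : Set (ℤ → Bool) :=
  {ω | ∀ (s : ℤ) (l : ℕ), ∃ (ξ : ℕ × ℕ → Bool) (p : ℕ × ℕ),
    ((List.range l).map fun u => ω (s + u)) <:+: basicBlock ξ p}

theorem vertexAt_zero (γ : ℕ → Bool) : vertexAt γ 0 = (0, 0) := by
  simp [vertexAt]

theorem vertexAt_succ (γ : ℕ → Bool) (n : ℕ) :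
    vertexAt γ (n + 1) = childOf (vertexAt γ n) (γ n) := by
  cases h : γ n <;> simp [vertexAt, childOf, Finset.range_add_one, Finset.filter_insert, h]

theorem vertexAt_add (γ : ℕ → Bool) (n : ℕ) : (vertexAt γ n).1 + (vertexAt γ n).2 = n := by
  induction n with
  | zero => simp [vertexAt_zero]
  | succ n ih =>
    rw [vertexAt_succ, childOf]
    split <;> simp only <;> omega

theorem vertexAt_congr {γ δ : ℕ → Bool} {n : ℕ} (h : ∀ i < n, γ i = δ i) :
    vertexAt γ n = vertexAt δ n := by
  induction n with
  | zero => simp [vertexAt_zero]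
  | succ n ih => rw [vertexAt_succ, vertexAt_succ, ih fun i hi => h i (by omega), h n (by omega)]

theorem vertexAt_eq_of_le {γ δ : ℕ → Bool} {m n : ℕ} (hv : vertexAt γ m = vertexAt δ m)
    (h : ∀ i, m ≤ i → γ i = δ i) (hmn : m ≤ n) : vertexAt γ n = vertexAt δ n := by
  induction n, hmn using Nat.le_induction with
  | base => exact hv
  | succ n hn ih => rw [vertexAt_succ, vertexAt_succ, ih, h n hn]

theorem isMaxEdge_congr {ξ : ℕ × ℕ → Bool} {γ δ : ℕ → Bool} {n : ℕ}
    (hv : vertexAt γ n = vertexAt δ n) (h : γ n = δ n) :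
    IsMaxEdge ξ γ n ↔ IsMaxEdge ξ δ n := by
  rw [IsMaxEdge, IsMaxEdge, hv, h]

/-- The vertex from which the move `b` enters `v`. -/
def sourceOf (v : ℕ × ℕ) (b : Bool) : ℕ × ℕ := if b then (v.1, v.2 - 1) else (v.1 - 1, v.2)

theorem sourceOf_childOf (v : ℕ × ℕ) (b : Bool) : sourceOf (childOf v b) b = v := by
  cases b <;> simp [sourceOf, childOf]

theorem childOf_sourceOf {v : ℕ × ℕ} (b : Bool) (h₁ : v.1 ≠ 0) (h₂ : v.2 ≠ 0) :
    childOf (sourceOf v b) b = v := by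
  obtain ⟨x, y⟩ := v
  cases b <;> simp [sourceOf, childOf] at * <;> omega

theorem vertexAt_eq_sourceOf (γ : ℕ → Bool) (n : ℕ) :
    vertexAt γ n = sourceOf (vertexAt γ (n + 1)) (γ n) := by
  rw [vertexAt_succ, sourceOf_childOf]

/-- A path starting with `l ++ [b]`, where `l` is a minimal path to `v` and the move `b` from `v`
is minimal, starts with a minimal path to the child of `v`. -/
theorem minimal_append {ξ : ℕ × ℕ → Bool} {l : List Bool} {v : ℕ × ℕ} {b : Bool}
    (h : l.length = v.1 + v.2 ∧ ∀ γ : ℕ → Bool, (∀ i < v.1 + v.2, γ i = l.getD i false) →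
      (∀ i < v.1 + v.2, IsMinEdge ξ γ i) ∧ vertexAt γ (v.1 + v.2) = v)
    (hb : MoveMin ξ v b) {w : ℕ × ℕ} (hw : childOf v b = w) :
    (l ++ [b]).length = w.1 + w.2 ∧
      ∀ γ : ℕ → Bool, (∀ i < w.1 + w.2, γ i = (l ++ [b]).getD i false) →
      (∀ i < w.1 + w.2, IsMinEdge ξ γ i) ∧ vertexAt γ (w.1 + w.2) = w := by
  obtain ⟨hl, h⟩ := h
  have hs : w.1 + w.2 = v.1 + v.2 + 1 := by
    rw [← hw, childOf]; split <;> simp only <;> omega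
  rw [hs]
  refine ⟨by simp [hl], fun γ hγ => ?_⟩
  have hγb : γ (v.1 + v.2) = b := by
    rw [hγ _ (by omega), ← hl]; simp
  obtain ⟨h₁, h₂⟩ := h γ fun i hi => by
    rw [hγ i (by omega), List.getD_append _ _ _ _ (by omega)]
  refine ⟨fun i hi => ?_, by rw [vertexAt_succ, h₂, hγb, hw]⟩
  rcases Nat.lt_succ_iff_lt_or_eq.mp hi with hi | rfl
  · exact h₁ i hi
  · rw [IsMinEdge, h₂, hγb]; exact hb

theorem minPath_spec (ξ : ℕ × ℕ → Bool) (v : ℕ × ℕ) :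
    (minPath ξ v).length = v.1 + v.2 ∧
      ∀ γ : ℕ → Bool, (∀ i < v.1 + v.2, γ i = (minPath ξ v).getD i false) →
      (∀ i < v.1 + v.2, IsMinEdge ξ γ i) ∧ vertexAt γ (v.1 + v.2) = v := by
  fun_induction minPath ξ v with
  | case1 => simp [vertexAt_zero]
  | case2 x ih => exact minimal_append ih (by simp [MoveMin, childOf]) (by simp [childOf])
  | case3 y ih => exact minimal_append ih (by simp [MoveMin, childOf]) (by simp [childOf])
  | case4 x y h ih => exact minimal_append ih (by simp [MoveMin, childOf, h]) (by simp [childOf])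
  | case5 x y h ih => exact minimal_append ih (by simp [MoveMin, childOf, h]) (by simp [childOf])

theorem adicT_spec {ξ : ℕ × ℕ → Bool} {γ : ℕ → Bool} {M : ℕ}
    (hmax : ∀ i < M, IsMaxEdge ξ γ i) (hM : ¬ IsMaxEdge ξ γ M) :
    (∀ i < M, IsMinEdge ξ (adicT ξ γ) i) ∧ adicT ξ γ M = !γ M ∧
      vertexAt (adicT ξ γ) (M + 1) = vertexAt γ (M + 1) ∧ ∀ i, M < i → adicT ξ γ i = γ i := by
  classical
  have hex : ∃ i, ¬ IsMaxEdge ξ γ i := ⟨M, hM⟩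
  have hfind : Nat.find hex = M :=
    (Nat.find_eq_iff hex).mpr ⟨hM, fun i hi => not_not.mpr (hmax i hi)⟩
  have hT : adicT ξ γ = fun n =>
      if n < M then (minPath ξ (sourceOf (vertexAt γ (M + 1)) (ξ (vertexAt γ (M + 1))))).getD n false
      else if n = M then ξ (vertexAt γ (M + 1)) else γ n := by
    rw [adicT, dif_pos hex]
    simp only [hfind, sourceOf]
  have hadd := vertexAt_add γ (M + 1)
  rw [IsMaxEdge, MoveMax, ← vertexAt_succ] at hM
  push Not at hM
  obtain ⟨h₁, h₂, h₃⟩ := hM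
  generalize vertexAt γ (M + 1) = v at *
  have hsum : (sourceOf v (ξ v)).1 + (sourceOf v (ξ v)).2 = M := by
    rw [sourceOf]; split <;> simp only <;> omega
  have hspec := (minPath_spec ξ (sourceOf v (ξ v))).2 (adicT ξ γ)
  rw [hsum] at hspec
  obtain ⟨hmin, hvert⟩ := hspec fun i hi => by rw [hT]; simp [hi]
  have hTM : adicT ξ γ M = ξ v := by rw [hT]; simp
  refine ⟨hmin, ?_, ?_, fun i hi => ?_⟩
  · rw [hTM]; revert h₃; cases γ M <;> cases ξ v <;> simp
  · rw [vertexAt_succ, hvert, hTM, childOf_sourceOf _ h₁ h₂]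
  · rw [hT]; simp [hi.ne', hi.not_gt]

theorem exists_iterate_isMaxEdge (ξ : ℕ × ℕ → Bool) (m : ℕ) (v : ℕ × ℕ) :
    ∃ r : ℕ, ∀ γ : ℕ → Bool, vertexAt γ m = v → (∀ i < m, IsMinEdge ξ γ i) →
      (∀ i < m, IsMaxEdge ξ ((adicT ξ)^[r] γ) i) ∧ vertexAt ((adicT ξ)^[r] γ) m = v ∧
        ∀ i, m ≤ i → (adicT ξ)^[r] γ i = γ i := by
  induction m generalizing v with
  | zero => exact ⟨0, fun γ hv _ => by simp [hv]⟩
  | succ m ih =>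
    by_cases hb : v.1 = 0 ∨ v.2 = 0
    · obtain ⟨r, hr⟩ := ih (sourceOf v (decide (v.1 = 0)))
      refine ⟨r, fun γ hv hmin => ?_⟩
      have hγ : γ m = decide (v.1 = 0) := by
        have hs := vertexAt_succ γ m
        have ha := vertexAt_add γ (m + 1)
        rw [hv] at hs ha
        cases h : γ m <;> simp [h, childOf] at hs <;> simp [hs] at hb ⊢
        exact hb
      obtain ⟨h₁, h₂, h₃⟩ := hr γ (by rw [vertexAt_eq_sourceOf, hv, hγ])
        fun i hi => hmin i (by omega)
      have h₄ : vertexAt ((adicT ξ)^[r] γ) (m + 1) = v := by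
        rw [vertexAt_succ, h₂, h₃ m le_rfl, ← hγ, ← hv, ← vertexAt_eq_sourceOf, vertexAt_succ]
      refine ⟨fun i hi => ?_, h₄, fun i hi => h₃ i (by omega)⟩
      rcases Nat.lt_succ_iff_lt_or_eq.mp hi with hi | rfl
      · exact h₁ i hi
      · rw [IsMaxEdge, MoveMax, ← vertexAt_succ, h₄]
        tauto
    · push Not at hb
      obtain ⟨r₁, hr₁⟩ := ih (sourceOf v (!ξ v))
      obtain ⟨r₂, hr₂⟩ := ih (sourceOf v (ξ v))
      refine ⟨r₂ + (1 + r₁), fun γ hv hmin => ?_⟩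
      rw [Function.iterate_add_apply, Function.iterate_add_apply, Function.iterate_one]
      have hγ : γ m = !ξ v := by
        have := hmin m (by omega)
        rw [IsMinEdge, MoveMin, ← vertexAt_succ, hv] at this
        tauto
      obtain ⟨h₁, h₂, h₃⟩ := hr₁ γ (by rw [vertexAt_eq_sourceOf, hv, hγ])
        fun i hi => hmin i (by omega)
      generalize (adicT ξ)^[r₁] γ = δ at *
      have hδm : δ m = !ξ v := by rw [h₃ m le_rfl, hγ]
      have hδ : vertexAt δ (m + 1) = v := by
        rw [vertexAt_succ, h₂, hδm, childOf_sourceOf _ hb.1 hb.2]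
      obtain ⟨k₁, k₂, k₃, k₄⟩ := adicT_spec h₁ (by
        rw [IsMaxEdge, MoveMax, ← vertexAt_succ, hδ, hδm]
        simp [hb.1, hb.2])
      generalize adicT ξ δ = ε at *
      have hεm : ε m = ξ v := by rw [k₂, hδm, Bool.not_not]
      obtain ⟨l₁, l₂, l₃⟩ := hr₂ ε (by rw [vertexAt_eq_sourceOf, k₃, hδ, hεm]) k₁
      have l₄ : vertexAt ((adicT ξ)^[r₂] ε) (m + 1) = v := by
        rw [vertexAt_succ, l₂, l₃ m le_rfl, hεm, childOf_sourceOf _ hb.1 hb.2]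
      refine ⟨fun i hi => ?_, l₄, fun i hi => ?_⟩
      · rcases Nat.lt_succ_iff_lt_or_eq.mp hi with hi | rfl
        · exact l₁ i hi
        · rw [IsMaxEdge, MoveMax, ← vertexAt_succ, l₄, l₃ i le_rfl, hεm]
          simp
      · rw [l₃ i (by omega), k₄ i (by omega), h₃ i (by omega)]

/-- `r` is a return time at level `m`: it sends each path that is minimal up to level `m` to the
next such path in its orbit. -/
def IsReturn (ξ : ℕ × ℕ → Bool) (m : ℕ) (v : ℕ × ℕ) (r : ℕ) : Prop :=
  ∀ γ : ℕ → Bool, vertexAt γ m = v → (∀ i < m, IsMinEdge ξ γ i) → ∀ M, m ≤ M →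
    (∀ i, m ≤ i → i < M → IsMaxEdge ξ γ i) → ¬ IsMaxEdge ξ γ M →
    (∀ i < M, IsMinEdge ξ ((adicT ξ)^[r] γ) i) ∧ (adicT ξ)^[r] γ M = !γ M ∧
      vertexAt ((adicT ξ)^[r] γ) (M + 1) = vertexAt γ (M + 1) ∧
      ∀ i, M < i → (adicT ξ)^[r] γ i = γ i

theorem exists_isReturn (ξ : ℕ × ℕ → Bool) (m : ℕ) (v : ℕ × ℕ) : ∃ r, IsReturn ξ m v r := by
  obtain ⟨r, hr⟩ := exists_iterate_isMaxEdge ξ m v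
  refine ⟨1 + r, fun γ hv hmin M hmM hmax hM => ?_⟩
  rw [Function.iterate_add_apply, Function.iterate_one]
  obtain ⟨h₁, h₂, h₃⟩ := hr γ hv hmin
  generalize (adicT ξ)^[r] γ = δ at *
  have hvert : ∀ i, m ≤ i → vertexAt δ i = vertexAt γ i :=
    fun i hi => vertexAt_eq_of_le (h₂.trans hv.symm) h₃ hi
  obtain ⟨k₁, k₂, k₃, k₄⟩ := adicT_spec (ξ := ξ) (γ := δ) (M := M)
    (fun i hi => if him : i < m then h₁ i him else
      (isMaxEdge_congr (hvert i (by omega)) (h₃ i (by omega))).mpr (hmax i (by omega) hi))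
    (by rwa [isMaxEdge_congr (hvert M hmM) (h₃ M hmM)])
  exact ⟨k₁, by rw [k₂, h₃ M hmM], by rw [k₃, hvert _ (by omega)],
    fun i hi => by rw [k₄ i hi, h₃ i (by omega)]⟩

theorem exists_not_isMaxEdge {ξ : ℕ × ℕ → Bool} {γ : ℕ → Bool} (hγ : γ ∉ XPrime ξ) :
    ∃ i, ¬ IsMaxEdge ξ γ i := by
  by_contra! h
  exact hγ ⟨γ, Or.inr h, 0, fun _ _ => rfl⟩

theorem adicT_notMem_XPrime {ξ : ℕ × ℕ → Bool} {γ : ℕ → Bool} (hγ : γ ∉ XPrime ξ) :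
    adicT ξ γ ∉ XPrime ξ := by
  classical
  have hex := exists_not_isMaxEdge hγ
  obtain ⟨-, -, -, h⟩ := adicT_spec (fun i hi => not_not.mp (Nat.find_min hex hi))
    (Nat.find_spec hex)
  rintro ⟨δ, hδ, N, hN⟩
  exact hγ ⟨δ, hδ, max N (Nat.find hex + 1), fun n hn => by
    rw [← h n (by omega), hN n (by omega)]⟩

theorem iterate_adicT_notMem_XPrime {ξ : ℕ × ℕ → Bool} {γ : ℕ → Bool} (hγ : γ ∉ XPrime ξ)
    (r : ℕ) : (adicT ξ)^[r] γ ∉ XPrime ξ := by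
  induction r with
  | zero => exact hγ
  | succ r ih => rw [Function.iterate_succ_apply']; exact adicT_notMem_XPrime ih

theorem IsReturn.isMinEdge_of_isMaxEdge {ξ : ℕ × ℕ → Bool} {m r : ℕ} {v : ℕ × ℕ}
    (hr : IsReturn ξ m v r) {γ : ℕ → Bool} (hγ : γ ∉ XPrime ξ) (hv : vertexAt γ m = v)
    (hmin : ∀ i < m, IsMinEdge ξ γ i) {M : ℕ}
    (hmax : ∀ i, m ≤ i → i < M → IsMaxEdge ξ γ i) :
    ∀ i < M, IsMinEdge ξ ((adicT ξ)^[r] γ) i := by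
  classical
  have hex : ∃ i, m ≤ i ∧ ¬ IsMaxEdge ξ γ i := by
    by_contra! h
    obtain ⟨s, hs⟩ := exists_iterate_isMaxEdge ξ m v
    obtain ⟨h₁, h₂, h₃⟩ := hs γ hv hmin
    have hvert : ∀ i, m ≤ i → vertexAt ((adicT ξ)^[s] γ) i = vertexAt γ i :=
      fun i hi => vertexAt_eq_of_le (h₂.trans hv.symm) h₃ hi
    refine hγ ⟨(adicT ξ)^[s] γ, Or.inr fun i => ?_, m, fun i hi => (h₃ i hi).symm⟩
    by_cases hi : i < m
    · exact h₁ i hi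
    · rw [isMaxEdge_congr (hvert i (by omega)) (h₃ i (by omega))]
      exact h i (by omega)
  obtain ⟨h₁, h₂⟩ := Nat.find_spec hex
  have hle : M ≤ Nat.find hex := by
    by_contra! h
    exact h₂ (hmax _ h₁ h)
  obtain ⟨h, -⟩ := hr γ hv hmin _ h₁ (fun i hi hlt => by
    by_contra hi'
    exact Nat.find_min hex hlt ⟨hi, hi'⟩) h₂
  exact fun i hi => h i (by omega)

theorem isMinEdge_iff {ξ : ℕ × ℕ → Bool} {γ : ℕ → Bool} {n : ℕ} {v : ℕ × ℕ}
    (hv : vertexAt γ (n + 1) = v) (h₁ : v.1 ≠ 0) (h₂ : v.2 ≠ 0) :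
    IsMinEdge ξ γ n ↔ γ n = !ξ v := by
  rw [IsMinEdge, MoveMin, ← vertexAt_succ, hv]
  simp [h₁, h₂]

theorem isMaxEdge_iff {ξ : ℕ × ℕ → Bool} {γ : ℕ → Bool} {n : ℕ} {v : ℕ × ℕ}
    (hv : vertexAt γ (n + 1) = v) (h₁ : v.1 ≠ 0) (h₂ : v.2 ≠ 0) :
    IsMaxEdge ξ γ n ↔ γ n = ξ v := by
  rw [IsMaxEdge, MoveMax, ← vertexAt_succ, hv]
  simp [h₁, h₂]

/-- The vertex with `a` moves equal to `c` and `b` moves equal to `!c`. -/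
def orient (c : Bool) (a b : ℕ) : ℕ × ℕ := if c then (b, a) else (a, b)

theorem childOf_orient (c : Bool) (a b : ℕ) : childOf (orient c a b) c = orient c (a + 1) b := by
  cases c <;> rfl

theorem childOf_orient_not (c : Bool) (a b : ℕ) :
    childOf (orient c a b) (!c) = orient c a (b + 1) := by
  cases c <;> rfl

theorem sourceOf_orient (c : Bool) (a b : ℕ) :
    sourceOf (orient c (a + 1) b) c = orient c a b := by
  rw [← childOf_orient, sourceOf_childOf]

theorem sourceOf_orient_not (c : Bool) (a b : ℕ) :
    sourceOf (orient c a (b + 1)) (!c) = orient c a b := by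
  rw [← childOf_orient_not, sourceOf_childOf]

theorem orient_inj {c : Bool} {a b a' b' : ℕ} :
    orient c a b = orient c a' b' ↔ a = a' ∧ b = b' := by
  cases c <;> simp [orient, and_comm]

theorem exists_eq_orient (c : Bool) (v : ℕ × ℕ) : ∃ a b, v = orient c a b := by
  cases c
  · exact ⟨v.1, v.2, rfl⟩
  · exact ⟨v.2, v.1, rfl⟩

theorem isMinEdge_iff_orient {ξ : ℕ × ℕ → Bool} {γ : ℕ → Bool} {n a b : ℕ} {c : Bool}
    (hv : vertexAt γ (n + 1) = orient c (a + 1) (b + 1)) :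
    IsMinEdge ξ γ n ↔ γ n = !ξ (orient c (a + 1) (b + 1)) :=
  isMinEdge_iff hv (by cases c <;> simp [orient]) (by cases c <;> simp [orient])

theorem isMaxEdge_iff_orient {ξ : ℕ × ℕ → Bool} {γ : ℕ → Bool} {n a b : ℕ} {c : Bool}
    (hv : vertexAt γ (n + 1) = orient c (a + 1) (b + 1)) :
    IsMaxEdge ξ γ n ↔ γ n = ξ (orient c (a + 1) (b + 1)) :=
  isMaxEdge_iff hv (by cases c <;> simp [orient]) (by cases c <;> simp [orient])

theorem not_isMaxEdge_of_isMinEdge {ξ : ℕ × ℕ → Bool} {γ : ℕ → Bool} {n a b : ℕ} {c : Bool}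
    (hv : vertexAt γ (n + 1) = orient c (a + 1) (b + 1)) (h : IsMinEdge ξ γ n) :
    ¬ IsMaxEdge ξ γ n := by
  rw [isMaxEdge_iff_orient hv, (isMinEdge_iff_orient hv).mp h]
  simp

/-- The return map exchanges the two edges into an interior vertex when the first is minimal. -/
theorem IsReturn.exchange {ξ : ℕ × ℕ → Bool} {m r : ℕ} {v : ℕ × ℕ}
    (hr : IsReturn ξ m v r) {γ : ℕ → Bool} (hv : vertexAt γ m = v)
    (hmin : ∀ i < m + 1, IsMinEdge ξ γ i) {c : Bool} {a b : ℕ}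
    (hw : vertexAt γ (m + 1) = orient c (a + 1) (b + 1)) :
    (∀ i < m, IsMinEdge ξ ((adicT ξ)^[r] γ) i) ∧ (adicT ξ)^[r] γ m = !γ m ∧
      IsMaxEdge ξ ((adicT ξ)^[r] γ) m ∧
      vertexAt ((adicT ξ)^[r] γ) (m + 1) = orient c (a + 1) (b + 1) ∧
      ∀ i, m + 1 ≤ i → (adicT ξ)^[r] γ i = γ i := by
  obtain ⟨h₁, h₂, h₃, h₄⟩ := hr γ hv (fun i hi => hmin i (by omega)) m le_rfl
    (fun i hi hi' => absurd hi' (by omega)) (not_isMaxEdge_of_isMinEdge hw (hmin m (by omega)))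
  rw [hw] at h₃
  refine ⟨h₁, h₂, ?_, h₃, fun i hi => h₄ i hi⟩
  rw [isMaxEdge_iff_orient h₃, h₂, (isMinEdge_iff_orient hw).mp (hmin m (by omega)), Bool.not_not]

theorem eq_not_of_ne {b c : Bool} (h : b ≠ c) : b = !c := by
  cases b <;> cases c <;> simp_all

/-- Two orbits that always agree at level `p + 3` cannot split at a boundary vertex there. -/
theorem not_split_at_boundary {ξ : ℕ × ℕ → Bool} {γ γ' : ℕ → Bool} (hγ : γ ∉ XPrime ξ)
    (hγ' : γ' ∉ XPrime ξ) {p : ℕ} {c : Bool}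
    (hsync : ∀ t, (∀ i < p + 3, IsMinEdge ξ ((adicT ξ)^[t] γ) i) →
      (∀ i < p + 3, IsMinEdge ξ ((adicT ξ)^[t] γ') i) →
      vertexAt ((adicT ξ)^[t] γ) (p + 3) = vertexAt ((adicT ξ)^[t] γ') (p + 3))
    (hmin : ∀ i < p + 4, IsMinEdge ξ γ i) (hmin' : ∀ i < p + 4, IsMinEdge ξ γ' i)
    (hv : vertexAt γ (p + 3) = orient c (p + 3) 0)
    (hc : γ (p + 3) = c) (hc' : γ' (p + 3) = !c) : False := by
  have hv' : vertexAt γ' (p + 3) = orient c (p + 3) 0 := by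
    rw [← hv]
    exact (hsync 0 (fun i hi => hmin i (by omega)) fun i hi => hmin' i (by omega)).symm
  have hw : vertexAt γ (p + 4) = orient c (p + 4) 0 := by
    rw [vertexAt_succ, hv, hc, childOf_orient]
  have hw' : vertexAt γ' (p + 4) = orient c (p + 3) 1 := by
    rw [vertexAt_succ, hv', hc', childOf_orient_not]
  have hmax : IsMaxEdge ξ γ (p + 3) := by
    rw [IsMaxEdge, MoveMax, ← vertexAt_succ, hw]
    cases c <;> simp [orient]
  have hξ₁ := (isMinEdge_iff_orient hw').mp (hmin' (p + 3) (by omega))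
  rw [hc'] at hξ₁
  obtain ⟨r, hr⟩ := exists_isReturn ξ (p + 3) (orient c (p + 3) 0)
  have hδ := iterate_adicT_notMem_XPrime hγ r
  have hδ' := iterate_adicT_notMem_XPrime hγ' r
  have hmin₁ := hr.isMinEdge_of_isMaxEdge hγ hv (fun i hi => hmin i (by omega)) (M := p + 4)
    fun i _ _ => (by omega : p + 3 = i) ▸ hmax
  obtain ⟨hmin₁', hc₁', hmax₁', hw₁', -⟩ := hr.exchange hv' hmin' hw'
  rw [hc', Bool.not_not] at hc₁'
  have hv₁' := vertexAt_eq_sourceOf ((adicT ξ)^[r] γ') (p + 3)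
  rw [hw₁', hc₁', sourceOf_orient] at hv₁'
  have hv₁ := (hsync r (fun i hi => hmin₁ i (by omega)) hmin₁').trans hv₁'
  have hc₁ : (adicT ξ)^[r] γ (p + 3) = !c := by
    refine eq_not_of_ne fun h => ?_
    have := (isMinEdge_iff_orient (by rw [vertexAt_succ, hv₁, h, childOf_orient])).mp
      (hmin₁ (p + 3) (by omega))
    rw [h, ← hξ₁] at this
    cases c <;> simp at this
  have hw₁ : vertexAt ((adicT ξ)^[r] γ) (p + 4) = orient c (p + 2) 2 := by
    rw [vertexAt_succ, hv₁, hc₁, childOf_orient_not]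
  have hξ₂ := (isMinEdge_iff_orient hw₁).mp (hmin₁ (p + 3) (by omega))
  rw [hc₁] at hξ₂
  have hmin₁_succ : ∀ i < p + 5, IsMinEdge ξ ((adicT ξ)^[r] γ) i := by
    by_cases h : IsMaxEdge ξ γ (p + 4)
    · exact hr.isMinEdge_of_isMaxEdge hγ hv (fun i hi => hmin i (by omega)) (M := p + 5)
        fun i _ _ => by
          obtain rfl | rfl : i = p + 3 ∨ i = p + 4 := by omega
          exacts [hmax, h]
    · exfalso
      obtain ⟨-, h₂, h₃, -⟩ := hr γ hv (fun i hi => hmin i (by omega)) (p + 4) (by omega)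
        (fun i _ _ => (by omega : p + 3 = i) ▸ hmax) h
      have hcu : γ (p + 4) = !c := by
        refine eq_not_of_ne fun hcu => h ?_
        rw [IsMaxEdge, MoveMax, ← vertexAt_succ, vertexAt_succ, hw, hcu, childOf_orient]
        cases c <;> simp [orient]
      have h₄ := vertexAt_eq_sourceOf ((adicT ξ)^[r] γ) (p + 4)
      rw [h₃, vertexAt_succ γ, hw, h₂, hcu, childOf_orient_not, Bool.not_not, sourceOf_orient, hw₁,
        orient_inj] at h₄
      omega
  generalize hδe : (adicT ξ)^[r] γ = δ at *
  generalize hδe' : (adicT ξ)^[r] γ' = δ' at *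
  replace hsync : ∀ t, (∀ i < p + 3, IsMinEdge ξ ((adicT ξ)^[t] δ) i) →
      (∀ i < p + 3, IsMinEdge ξ ((adicT ξ)^[t] δ') i) →
      vertexAt ((adicT ξ)^[t] δ) (p + 3) = vertexAt ((adicT ξ)^[t] δ') (p + 3) := by
    intro t
    have := hsync (t + r)
    rwa [Function.iterate_add_apply, Function.iterate_add_apply, hδe, hδe'] at this
  clear hδe hδe' hγ hγ' hmin hmin' hv hc hc' hv' hw hw' hmax hr γ γ' r
  obtain ⟨r, hr⟩ := exists_isReturn ξ (p + 3) (orient c (p + 2) 1)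
  have hε := iterate_adicT_notMem_XPrime hδ r
  obtain ⟨hmin₂, hc₂, hmax₂, hw₂, htail⟩ := hr.exchange hv₁ hmin₁ hw₁
  have hmin₂' := hr.isMinEdge_of_isMaxEdge hδ' hv₁' hmin₁' (M := p + 4)
    fun i _ _ => (by omega : p + 3 = i) ▸ hmax₁'
  rw [hc₁, Bool.not_not] at hc₂
  have hv₂ := vertexAt_eq_sourceOf ((adicT ξ)^[r] δ) (p + 3)
  rw [hw₂, hc₂, sourceOf_orient] at hv₂
  have hv₂' := (hsync r hmin₂ (fun i hi => hmin₂' i (by omega))).symm.trans hv₂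
  have hc₂' : (adicT ξ)^[r] δ' (p + 3) = !c := by
    refine eq_not_of_ne fun h => ?_
    have := (isMinEdge_iff_orient (by rw [vertexAt_succ, hv₂', h, childOf_orient])).mp
      (hmin₂' (p + 3) (by omega))
    rw [h, ← hξ₂] at this
    cases c <;> simp at this
  have hw₂' : vertexAt ((adicT ξ)^[r] δ') (p + 4) = orient c (p + 1) 3 := by
    rw [vertexAt_succ, hv₂', hc₂', childOf_orient_not]
  have hξ₃ := (isMinEdge_iff_orient hw₂').mp (hmin₂' (p + 3) (by omega))
  rw [hc₂'] at hξ₃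
  obtain ⟨s, hs⟩ := exists_isReturn ξ (p + 3) (orient c (p + 1) 2)
  have hmin₃ := hs.isMinEdge_of_isMaxEdge hε hv₂ hmin₂ (M := p + 4)
    fun i _ _ => (by omega : p + 3 = i) ▸ hmax₂
  obtain ⟨hmin₃', hc₃', -, hw₃', -⟩ := hs.exchange hv₂' hmin₂' hw₂'
  rw [hc₂', Bool.not_not] at hc₃'
  have hv₃' := vertexAt_eq_sourceOf ((adicT ξ)^[s] ((adicT ξ)^[r] δ')) (p + 3)
  rw [hw₃', hc₃', sourceOf_orient] at hv₃'
  have hsync₃ := hsync (s + r)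
  rw [Function.iterate_add_apply, Function.iterate_add_apply] at hsync₃
  have hv₃ := (hsync₃ (fun i hi => hmin₃ i (by omega)) hmin₃').trans hv₃'
  have hc₃ : (adicT ξ)^[s] ((adicT ξ)^[r] δ) (p + 3) = !c := by
    refine eq_not_of_ne fun h => ?_
    have := (isMinEdge_iff_orient (by rw [vertexAt_succ, hv₃, h, childOf_orient])).mp
      (hmin₃ (p + 3) (by omega))
    rw [h, ← hξ₃] at this
    cases c <;> simp at this
  have hw₃ : vertexAt ((adicT ξ)^[s] ((adicT ξ)^[r] δ)) (p + 4) = orient c p 4 := by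
    rw [vertexAt_succ, hv₃, hc₃, childOf_orient_not]
  have htop : vertexAt ((adicT ξ)^[r] δ) (p + 5) = vertexAt δ (p + 5) :=
    vertexAt_eq_of_le (hw₂.trans hw₁.symm) htail (by omega)
  have hnot : ¬ IsMaxEdge ξ ((adicT ξ)^[r] δ) (p + 4) := by
    rw [isMaxEdge_congr (hw₂.trans hw₁.symm) (htail _ le_rfl)]
    by_cases h : δ (p + 4) = c
    · exact not_isMaxEdge_of_isMinEdge (c := c) (a := p + 2) (b := 1)
        (by rw [vertexAt_succ, hw₁, h, childOf_orient]) (hmin₁_succ _ (by omega))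
    · exact not_isMaxEdge_of_isMinEdge (c := c) (a := p + 1) (b := 2)
        (by rw [vertexAt_succ, hw₁, eq_not_of_ne h, childOf_orient_not])
        (hmin₁_succ _ (by omega))
  obtain ⟨-, h₂, h₃, -⟩ := hs _ hv₂ hmin₂ (p + 4) (by omega)
    (fun i _ _ => (by omega : p + 3 = i) ▸ hmax₂) hnot
  have h₄ := vertexAt_eq_sourceOf ((adicT ξ)^[s] ((adicT ξ)^[r] δ)) (p + 4)
  rw [h₃, htop, vertexAt_succ δ, hw₁, h₂, htail _ le_rfl, hw₃] at h₄
  by_cases h : δ (p + 4) = c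
  · rw [h, childOf_orient, sourceOf_orient_not, orient_inj] at h₄
    omega
  · rw [eq_not_of_ne h, childOf_orient_not, Bool.not_not, sourceOf_orient, orient_inj] at h₄
    omega

theorem vertexAt_eq_of_forall_iterate_eq {ξ : ℕ × ℕ → Bool} (n : ℕ) {γ γ' : ℕ → Bool}
    (hγ : γ ∉ XPrime ξ) (hγ' : γ' ∉ XPrime ξ)
    (hcode : ∀ t, ∀ i < 3, (adicT ξ)^[t] γ i = (adicT ξ)^[t] γ' i)
    (hmin : ∀ i < n, IsMinEdge ξ γ i) (hmin' : ∀ i < n, IsMinEdge ξ γ' i) :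
    vertexAt γ n = vertexAt γ' n := by
  induction n generalizing γ γ' with
  | zero => simp [vertexAt_zero]
  | succ n ih =>
    by_cases hn : n < 3
    · exact vertexAt_congr fun i hi => hcode 0 i (by omega)
    obtain ⟨p, rfl⟩ : ∃ p, n = p + 3 := ⟨n - 3, by omega⟩
    have hsync : ∀ t, (∀ i < p + 3, IsMinEdge ξ ((adicT ξ)^[t] γ) i) →
        (∀ i < p + 3, IsMinEdge ξ ((adicT ξ)^[t] γ') i) →
        vertexAt ((adicT ξ)^[t] γ) (p + 3) = vertexAt ((adicT ξ)^[t] γ') (p + 3) := fun t =>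
      ih (iterate_adicT_notMem_XPrime hγ t) (iterate_adicT_notMem_XPrime hγ' t) fun u i hi => by
        rw [← Function.iterate_add_apply, ← Function.iterate_add_apply]
        exact hcode (u + t) i hi
    have hv := hsync 0 (fun i hi => hmin i (by omega)) fun i hi => hmin' i (by omega)
    simp only [Function.iterate_zero, id] at hv
    by_contra hne
    obtain ⟨c, hc⟩ : ∃ c, γ (p + 3) = c := ⟨_, rfl⟩
    have hc' : γ' (p + 3) = !c := by
      refine eq_not_of_ne fun h => hne ?_
      rw [vertexAt_succ γ, vertexAt_succ γ', hv, hc, h]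
    obtain ⟨a, b, hab⟩ := exists_eq_orient c (vertexAt γ (p + 3))
    have hsum : a + b = p + 3 := by
      have := vertexAt_add γ (p + 3)
      rw [hab] at this
      cases c <;> simp [orient] at this <;> omega
    rcases b with _ | b
    · obtain rfl : a = p + 3 := by omega
      exact not_split_at_boundary hγ hγ' hsync hmin hmin' hab hc hc'
    rcases a with _ | a
    · refine not_split_at_boundary (c := !c) hγ' hγ (fun t h h' => (hsync t h' h).symm) hmin' hmin
        ?_ hc' (by rw [hc, Bool.not_not])
      rw [← hv, hab, ← hsum]
      cases c <;> simp [orient]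
    obtain ⟨r, hr⟩ := exists_isReturn ξ (p + 3) (vertexAt γ (p + 3))
    have hw : vertexAt γ (p + 4) = orient c (a + 1 + 1) (b + 1) := by
      rw [vertexAt_succ, hab, hc, childOf_orient]
    have hw' : vertexAt γ' (p + 4) = orient c (a + 1) (b + 1 + 1) := by
      rw [vertexAt_succ, ← hv, hab, hc', childOf_orient_not]
    obtain ⟨h₁, h₂, -, h₃, -⟩ := hr.exchange rfl hmin hw
    obtain ⟨h₁', h₂', -, h₃', -⟩ := hr.exchange hv.symm hmin' hw'
    have := hsync r h₁ h₁'
    rw [vertexAt_eq_sourceOf, h₃, h₂, hc, sourceOf_orient_not, vertexAt_eq_sourceOf, h₃', h₂', hc',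
      Bool.not_not, sourceOf_orient, orient_inj] at this
    omega

theorem stmt4 (ξ : ℕ × ℕ → Bool) (γ γ' : ℕ → Bool)
    (hγ : γ ∉ XPrime ξ) (hγ' : γ' ∉ XPrime ξ) (hne : γ ≠ γ')
    (n x y x' y' : ℕ) (hn : 1 ≤ n)
    (hxy : x + y = n) (hxy' : x' + y' = n) (hvne : (x, y) ≠ (x', y'))
    (hv : vertexAt γ n = (x, y)) (hv' : vertexAt γ' n = (x', y'))
    (hmin : ∀ i < n, IsMinEdge ξ γ i) (hmin' : ∀ i < n, IsMinEdge ξ γ' i) :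
    omegaCode ξ 3 γ ≠ omegaCode ξ 3 γ' := by
  intro h
  refine hvne ?_
  rw [← hv, ← hv']
  refine vertexAt_eq_of_forall_iterate_eq n hγ hγ' (fun t i hi => ?_) hmin hmin'
  exact List.map_inj_left.mp (congrFun h (Int.ofNat t)) i (List.mem_range.mpr hi)
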